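/- Let $f\in L_p(\mathbb{T})$, $1\le p<\infty$, $r,n\in\mathbb{N}$, and suppose the sampling operators $G_n$ satisfy conditions (c1), (c1') and (c2') for some $s\in\mathbb{N}$ with $s\le 2r$. Then there exists a constant $C_2>0$ independent of $f$ and $n$ such that $K_2\|f_{\gamma/n,\,r}-f\|_{\ell_p(X_n)}-C_2\,\omega_s(f,1/n)_p\le \|f-G_n(f)\|_p$. -/

import Mathlib

open MeasureTheory Filter Finset

noncomputable def LpNorm (p : ℝ) (f : ℝ → ℝ) : ℝ :=
  (∫ x in (0:ℝ)..1, |f x| ^ p) ^ (1 / p)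

def MemLpT (p : ℝ) (f : ℝ → ℝ) : Prop :=
  Function.Periodic f 1 ∧ Measurable f ∧
    IntervalIntegrable (fun x => |f x| ^ p) MeasureTheory.volume 0 1

noncomputable def Delta (r : ℕ) (h : ℝ) (f : ℝ → ℝ) (x : ℝ) : ℝ :=
  ∑ ν ∈ Finset.range (r + 1), ((-1 : ℝ) ^ ν * (r.choose ν : ℝ)) * f (x + ((r : ℝ) - (ν : ℝ)) * h)

noncomputable def omegaMod (r : ℕ) (p : ℝ) (f : ℝ → ℝ) (δ : ℝ) : ℝ :=
  sSup {y | ∃ h : ℝ, 0 < h ∧ h < δ ∧ y = LpNorm p (Delta r h f)}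

noncomputable def steklov (r : ℕ) (δ : ℝ) (f : ℝ → ℝ) (x : ℝ) : ℝ :=
  (-1 : ℝ) ^ (r + 1) * (((2 * r).choose r : ℝ))⁻¹ * (2 / δ) *
    ∫ t in (-(δ / 2))..(δ / 2),
      ∑ ν ∈ Finset.range r,
        (-1 : ℝ) ^ ν * (((2 * r).choose ν : ℝ)) * f (x + (((r : ℝ) - (ν : ℝ)) / (r : ℝ)) * t)

noncomputable def ellp (p : ℝ) (n : ℕ) (x : ℕ → ℝ) (f : ℝ → ℝ) : ℝ :=
  ((1 / (n : ℝ)) * ∑ k ∈ Finset.range n, |f (x k)| ^ p) ^ (1 / p)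

def SobolevW (s : ℕ) (g : ℝ → ℝ) : Prop :=
  Function.Periodic g 1 ∧ ContDiff ℝ (s : ℕ∞) g

noncomputable def localMod (r : ℕ) (f : ℝ → ℝ) (x δ : ℝ) : ℝ :=
  sSup {y | ∃ t h : ℝ, t ∈ Set.Icc (x - r * δ / 2) (x + r * δ / 2) ∧
    (t + r * h) ∈ Set.Icc (x - r * δ / 2) (x + r * δ / 2) ∧ y = |Delta r h f t|}

noncomputable def tauMod (r : ℕ) (p : ℝ) (f : ℝ → ℝ) (δ : ℝ) : ℝ :=
  (∫ x in (0:ℝ)..1, localMod r f x δ ^ p) ^ (1 / p)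

def IsTrigPoly (n : ℕ) (T : ℝ → ℝ) : Prop :=
  ∃ c : ℤ → ℂ, ∀ x : ℝ, (T x : ℂ) =
    ∑ ℓ ∈ Finset.Icc (-(n : ℤ)) (n : ℤ),
      c ℓ * Complex.exp (2 * Real.pi * Complex.I * (ℓ : ℂ) * (x : ℂ))

noncomputable def tildeE (n : ℕ) (p : ℝ) (f : ℝ → ℝ) : ℝ :=
  sInf {y | ∃ Q q : ℝ → ℝ, IsTrigPoly n Q ∧ IsTrigPoly n q ∧
    (∀ x, q x ≤ f x ∧ f x ≤ Q x) ∧ y = LpNorm p (fun x => Q x - q x)}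

noncomputable def dirichlet (n : ℕ) (x : ℝ) : ℝ :=
  ∑ ℓ ∈ Finset.Icc (-(n : ℤ)) (n : ℤ), Real.cos (2 * Real.pi * (ℓ : ℝ) * x)

noncomputable def lagrange (n : ℕ) (f : ℝ → ℝ) (x : ℝ) : ℝ :=
  (1 / (2 * (n : ℝ) + 1)) * ∑ k ∈ Finset.range (2 * n + 1),
    f ((k : ℝ) / (2 * (n : ℝ) + 1)) * dirichlet n (x - (k : ℝ) / (2 * (n : ℝ) + 1))

def NodesOK (γ : ℝ) (X : ℕ → ℕ → ℝ) : Prop :=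
  ∀ n : ℕ, 1 ≤ n →
    (0 ≤ X n 0) ∧ (∀ k, k + 1 < n → X n k < X n (k + 1)) ∧ (X n (n - 1) < 1) ∧
    (∀ k, k + 1 < n → γ / (n : ℝ) ≤ X n (k + 1) - X n k) ∧
    (γ / (n : ℝ) ≤ 1 + X n 0 - X n (n - 1))

def NodesOrd (X : ℕ → ℕ → ℝ) : Prop :=
  ∀ n : ℕ, 1 ≤ n →
    (0 ≤ X n 0) ∧ (∀ k, k + 1 < n → X n k < X n (k + 1)) ∧ (X n (n - 1) < 1)

def SamplingForm (p : ℝ) (X : ℕ → ℕ → ℝ) (φ : ℕ → ℕ → ℝ → ℝ)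
    (G : ℕ → (ℝ → ℝ) → ℝ → ℝ) : Prop :=
  (∀ n k, MemLpT p (φ n k)) ∧
  ∀ (n : ℕ) (f : ℝ → ℝ) (x : ℝ), G n f x = ∑ k ∈ Finset.range n, f (X n k) * φ n k x

def CondC1 (p K1 : ℝ) (X : ℕ → ℕ → ℝ) (G : ℕ → (ℝ → ℝ) → ℝ → ℝ) : Prop :=
  ∀ f : ℝ → ℝ, MemLpT p f → ∀ n : ℕ, 1 ≤ n → LpNorm p (G n f) ≤ K1 * ellp p n (X n) f

def CondC1' (p K2 : ℝ) (X : ℕ → ℕ → ℝ) (G : ℕ → (ℝ → ℝ) → ℝ → ℝ) : Prop :=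
  ∀ f : ℝ → ℝ, MemLpT p f → ∀ n : ℕ, 1 ≤ n → K2 * ellp p n (X n) f ≤ LpNorm p (G n f)

def CondC2' (p K3 : ℝ) (s : ℕ) (G : ℕ → (ℝ → ℝ) → ℝ → ℝ) : Prop :=
  ∀ g : ℝ → ℝ, SobolevW s g → ∀ n : ℕ, 1 ≤ n →
    LpNorm p (fun x => g x - G n g x) ≤ K3 / (n : ℝ) ^ s * LpNorm p (iteratedDeriv s g)

def CondC3 (p K5 : ℝ) (s : ℕ) (G : ℕ → (ℝ → ℝ) → ℝ → ℝ) : Prop :=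
  ∀ f : ℝ → ℝ, MemLpT p f → ∀ n : ℕ, 1 ≤ n →
    SobolevW s (G n f) ∧
    (1 / (n : ℝ) ^ s) * LpNorm p (iteratedDeriv s (G n f)) ≤
      K5 * omegaMod s p (G n f) (1 / (n : ℝ))

noncomputable def Gprev (G : ℕ → (ℝ → ℝ) → ℝ → ℝ) (f : ℝ → ℝ) (ν : ℕ) : ℝ → ℝ :=
  if ν = 0 then fun _ => 0 else G (2 ^ (ν - 1)) f

def CondC4 (p K4 : ℝ) (s : ℕ) (G : ℕ → (ℝ → ℝ) → ℝ → ℝ) (f : ℝ → ℝ) : Prop :=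
  ∀ ν : ℕ,
    SobolevW s (fun x => G (2 ^ ν) f x - Gprev G f ν x) ∧
    LpNorm p (iteratedDeriv s (fun x => G (2 ^ ν) f x - Gprev G f ν x)) ≤
      K4 * 2 ^ (s * ν) * LpNorm p (fun x => G (2 ^ ν) f x - Gprev G f ν x)

noncomputable def Kfun (s : ℕ) (p : ℝ) (n : ℕ) (x : ℕ → ℝ) (f : ℝ → ℝ) : ℝ :=
  sInf {y | ∃ g : ℝ → ℝ, SobolevW s g ∧
    y = ellp p n x (fun t => f t - g t) + LpNorm p (fun t => f t - g t) +
        (1 / (n : ℝ) ^ s) * LpNorm p (iteratedDeriv s g)}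


noncomputable def VV : Measure ℝ := volume.restrict (Set.Ioc 0 1)

instance : IsProbabilityMeasure VV := ⟨by simp [VV]⟩

noncomputable def nodeM (n : ℕ) (x : ℕ → ℝ) : Measure ℝ := ∑ k ∈ Finset.range n, Measure.dirac (x k)

instance (n : ℕ) (x : ℕ → ℝ) : IsFiniteMeasure (nodeM n x) := by
  unfold nodeM; infer_instance

lemma eLp_eq {p : ℝ} (hp : 1 ≤ p) (ρ : Measure ℝ) (F : ℝ → ℝ) :
    eLpNorm F (ENNReal.ofReal p) ρ = (∫⁻ x, ‖F x‖ₑ ^ p ∂ρ) ^ (1 / p) := by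
  have h0 : ENNReal.ofReal p ≠ 0 := by simp; linarith
  rw [eLpNorm_eq_lintegral_rpow_enorm_toReal h0 ENNReal.ofReal_ne_top,
    ENNReal.toReal_ofReal (by linarith)]

lemma abs_rpow_ofReal {p : ℝ} (hp : 1 ≤ p) (y : ℝ) : ENNReal.ofReal (|y| ^ p) = ‖y‖ₑ ^ p := by
  rw [← ENNReal.ofReal_rpow_of_nonneg (abs_nonneg _) (by linarith), ← Real.norm_eq_abs, ofReal_norm]

lemma abs_pow_meas (p : ℝ) {F : ℝ → ℝ} (hF : Measurable F) : Measurable fun x => |F x| ^ p :=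
  hF.norm.pow_const p

lemma LpNorm_eq {p : ℝ} (hp : 1 ≤ p) {F : ℝ → ℝ} (hF : Measurable F) :
    LpNorm p F = (eLpNorm F (ENNReal.ofReal p) VV).toReal := by
  rw [eLp_eq hp, ← ENNReal.toReal_rpow, LpNorm, intervalIntegral.integral_of_le zero_le_one,
    integral_eq_lintegral_of_nonneg_ae (Eventually.of_forall fun x => by positivity)
      ((abs_pow_meas p hF).aestronglyMeasurable)]
  simp only [abs_rpow_ofReal hp, VV]

lemma ellp_eq {p : ℝ} (hp : 1 ≤ p) {n : ℕ} (x : ℕ → ℝ) (F : ℝ → ℝ) :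
    ellp p n x F = (1 / (n : ℝ)) ^ (1 / p) * (eLpNorm F (ENNReal.ofReal p) (nodeM n x)).toReal := by
  rw [eLp_eq hp, ← ENNReal.toReal_rpow, ellp, Real.mul_rpow (by positivity) (by positivity), nodeM,
    lintegral_finsetSum_measure]
  simp only [lintegral_dirac, ← abs_rpow_ofReal hp]
  rw [← ENNReal.ofReal_sum_of_nonneg (fun i _ => by positivity), ENNReal.toReal_ofReal (by positivity)]

lemma lintegral_jensen {p : ℝ} (hp : 1 ≤ p) (μ : Measure ℝ) [IsProbabilityMeasure μ] {φ : ℝ → ℝ}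
    (hφ : Measurable φ) : ‖∫ u, φ u ∂μ‖ₑ ^ p ≤ ∫⁻ u, ‖φ u‖ₑ ^ p ∂μ := by
  have hp0 : 0 < p := by linarith
  have h1 : ‖∫ u, φ u ∂μ‖ₑ ≤ (∫⁻ u, ‖φ u‖ₑ ^ p ∂μ) ^ (1 / p) := by
    calc ‖∫ u, φ u ∂μ‖ₑ ≤ ∫⁻ u, ‖φ u‖ₑ ∂μ := enorm_integral_le_lintegral_enorm _
      _ = eLpNorm φ 1 μ := eLpNorm_one_eq_lintegral_enorm.symm
      _ ≤ eLpNorm φ (ENNReal.ofReal p) μ :=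
        eLpNorm_le_eLpNorm_of_exponent_le (by simpa using hp) hφ.aestronglyMeasurable
      _ = _ := eLp_eq hp μ φ
  calc _ ≤ ((∫⁻ u, ‖φ u‖ₑ ^ p ∂μ) ^ (1 / p)) ^ p := by gcongr
    _ = _ := by rw [← ENNReal.rpow_mul]; simp [hp0.ne']

lemma mink_pow {p : ℝ} (hp : 1 ≤ p) (ρ μ : Measure ℝ) [SFinite ρ] [IsProbabilityMeasure μ]
    {K : ℝ → ℝ → ℝ} (hK : Measurable (Function.uncurry K)) :
    eLpNorm (fun x => ∫ u, K x u ∂μ) (ENNReal.ofReal p) ρ ≤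
      (∫⁻ u, ∫⁻ x, ‖K x u‖ₑ ^ p ∂ρ ∂μ) ^ (1 / p) := by
  rw [eLp_eq hp]
  have hp0 : 0 < p := by linarith
  refine ENNReal.rpow_le_rpow ?_ (by positivity)
  calc _ ≤ ∫⁻ x, ∫⁻ u, ‖K x u‖ₑ ^ p ∂μ ∂ρ :=
        lintegral_mono fun x => lintegral_jensen hp μ (hK.of_uncurry_left)
    _ = _ := by
      rw [lintegral_lintegral_swap]
      have : Measurable fun z : ℝ × ℝ => ‖Function.uncurry K z‖ₑ ^ p := by fun_prop
      exact this.aemeasurable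

lemma mink_sup {p : ℝ} (hp : 1 ≤ p) (ρ μ : Measure ℝ) [SFinite ρ] [IsProbabilityMeasure μ]
    {K : ℝ → ℝ → ℝ} (hK : Measurable (Function.uncurry K)) (B : ENNReal)
    (hB : ∀ᵐ u ∂μ, eLpNorm (fun x => K x u) (ENNReal.ofReal p) ρ ≤ B) :
    eLpNorm (fun x => ∫ u, K x u ∂μ) (ENNReal.ofReal p) ρ ≤ B := by
  have hp0 : 0 < p := by linarith
  refine (mink_pow hp ρ μ hK).trans ?_
  calc _ ≤ (∫⁻ u, B ^ p ∂μ) ^ (1 / p) := by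
        refine ENNReal.rpow_le_rpow (lintegral_mono_ae ?_) (by positivity)
        filter_upwards [hB] with u hu
        rw [eLp_eq hp] at hu
        calc _ = ((∫⁻ x, ‖K x u‖ₑ ^ p ∂ρ) ^ (1 / p)) ^ p := by
              rw [← ENNReal.rpow_mul]; simp [hp0.ne']
          _ ≤ _ := by gcongr
    _ = B := by
      rw [lintegral_const, measure_univ, mul_one, ← ENNReal.rpow_mul]; simp [hp0.ne']

lemma per_lint {H : ℝ → ENNReal} (hH : Function.Periodic H 1) (t : ℝ) :
    ∫⁻ x in Set.Ioc t (t + 1), H x = ∫⁻ x in Set.Ioc (0:ℝ) 1, H x := by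
  have h := (isAddFundamentalDomain_Ioc (one_pos : (0:ℝ) < 1) t volume).setLIntegral_eq
    (isAddFundamentalDomain_Ioc (one_pos : (0:ℝ) < 1) 0 volume) H hH.map_vadd_zmultiples
  simpa using h

lemma affine_lint {H : ℝ → ENNReal} {b : ℝ} (hb : 0 < b) (c α β : ℝ) :
    ∫⁻ v in Set.Ioc α β, H (c + b * v) =
      ENNReal.ofReal (1 / b) * ∫⁻ y in Set.Ioc (c + b * α) (c + b * β), H y := by
  have him : (fun v => c + b * v) '' Set.Ioc α β = Set.Ioc (c + b * α) (c + b * β) := by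
    have h1 : (fun v => c + b * v) = (fun y => c + y) ∘ (fun v => b * v) := rfl
    rw [h1, Set.image_comp, Set.image_mul_left_Ioc hb, Set.image_const_add_Ioc]
  have h := lintegral_image_eq_lintegral_abs_deriv_mul (s := Set.Ioc α β) (f := fun v => c + b * v)
    (f' := fun _ => b) measurableSet_Ioc
    (fun x _ => by
      have := ((hasDerivAt_id x).const_mul b).const_add c
      simpa using this.hasDerivWithinAt)
    (fun x _ y _ hxy => by simpa [hb.ne'] using hxy) H
  rw [him] at h
  rw [h, lintegral_const_mul' _ _ ENNReal.ofReal_ne_top, ← mul_assoc, ← ENNReal.ofReal_mul (by positivity),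
    abs_of_pos hb]
  simp [hb.ne']

lemma shift_eLp {p : ℝ} (hp : 1 ≤ p) {F : ℝ → ℝ} (hF : Function.Periodic F 1) (c : ℝ) :
    eLpNorm (fun x => F (x + c)) (ENNReal.ofReal p) VV = eLpNorm F (ENNReal.ofReal p) VV := by
  rw [eLp_eq hp, eLp_eq hp]
  congr 1
  have := affine_lint (H := fun x => ‖F x‖ₑ ^ p) one_pos c 0 1
  simp only [one_mul, mul_zero, mul_one, add_zero, div_one, ENNReal.ofReal_one] at this
  simp only [VV, add_comm _ c]
  rw [this, per_lint]
  intro x; simp only [hF x]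

lemma telescope_lint (H : ℝ → ENNReal) (y : ℕ → ℝ) (n : ℕ) (hy : ∀ k < n, y k ≤ y (k + 1)) :
    y 0 ≤ y n ∧ ∑ k ∈ Finset.range n, ∫⁻ x in Set.Ioc (y k) (y (k + 1)), H x =
      ∫⁻ x in Set.Ioc (y 0) (y n), H x := by
  induction n with
  | zero => simp
  | succ n ih =>
    obtain ⟨h1, h2⟩ := ih fun k hk => hy k (by omega)
    have h3 := hy n (by omega)
    refine ⟨h1.trans h3, ?_⟩
    rw [Finset.sum_range_succ, h2, ← Set.Ioc_union_Ioc_eq_Ioc h1 h3,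
      lintegral_union measurableSet_Ioc]
    exact Set.Ioc_disjoint_Ioc_of_le le_rfl

lemma node_avg {γ : ℝ} {X : ℕ → ℕ → ℝ} (hX : NodesOK γ X) {n : ℕ} (hn : 1 ≤ n) (hγ : 0 < γ)
    {H : ℝ → ENNReal} (hH : Function.Periodic H 1) {b : ℝ} (hb : 0 < b) (c α β : ℝ)
    (hL : b * (β - α) ≤ γ / n) :
    ∑ k ∈ Finset.range n, ∫⁻ v in Set.Ioc α β, H (X n k + c + b * v) ≤
      ENNReal.ofReal (1 / b) * ∫⁻ x in Set.Ioc (0:ℝ) 1, H x := by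
  obtain ⟨-, -, -, h4, h5⟩ := hX n hn
  have hγn : 0 ≤ γ / n := by positivity
  let y : ℕ → ℝ := fun k => (if k < n then X n k else 1 + X n 0) + c + b * α
  have hy : ∀ k < n, y k + γ / n ≤ y (k + 1) := by
    intro k hk
    simp only [y, hk, if_true]
    split_ifs with h
    · linarith [h4 k h]
    · have : k = n - 1 := by omega
      subst this; linarith
  have hT := telescope_lint H y n (fun k hk => by linarith [hy k hk])
  have hyn : y n = y 0 + 1 := by
    have : 0 < n := hn
    simp [y, this]; ring
  rw [hyn, per_lint hH] at hT
  rw [← hT.2, Finset.mul_sum]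
  refine Finset.sum_le_sum fun k hk => ?_
  rw [affine_lint hb]
  gcongr
  · simp [y, Finset.mem_range.1 hk]
  · have := hy k (Finset.mem_range.1 hk)
    refine le_trans ?_ this
    simp only [y, Finset.mem_range.1 hk, if_true]
    linarith


lemma Delta_eq_iter (m : ℕ) (h : ℝ) (F : ℝ → ℝ) : Delta m h F = (fwdDiff h)^[m] F := by
  funext x
  rw [fwdDiff_iter_eq_sum_shift, Delta, ← Finset.sum_range_reflect]
  refine Finset.sum_congr rfl fun k hk => ?_
  have hk' : k ≤ m := by simpa [Nat.lt_succ_iff] using hk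
  have e : m + 1 - 1 - k = m - k := by omega
  rw [e, Nat.choose_symm hk', Nat.cast_sub hk']
  simp only [zsmul_eq_mul, nsmul_eq_mul]
  push_cast
  congr 2
  ring_nf

lemma Delta_add (a b : ℕ) (h : ℝ) (F : ℝ → ℝ) : Delta (a + b) h F = Delta a h (Delta b h F) := by
  simp only [Delta_eq_iter, Function.iterate_add_apply]

lemma Delta_meas (m : ℕ) (h : ℝ) {F : ℝ → ℝ} (hF : Measurable F) : Measurable (Delta m h F) := by
  unfold Delta; fun_prop

lemma Delta_per (m : ℕ) (h : ℝ) {F : ℝ → ℝ} (hF : Function.Periodic F 1) :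
    Function.Periodic (Delta m h F) 1 := by
  intro x
  unfold Delta
  refine Finset.sum_congr rfl fun k _ => ?_
  rw [show x + 1 + ((m:ℝ) - k) * h = x + ((m:ℝ) - k) * h + 1 by ring, hF]

lemma Delta_neg (m : ℕ) (h : ℝ) (F : ℝ → ℝ) (x : ℝ) :
    Delta m (-h) F x = (-1) ^ m * Delta m h F (x + (-(m * h))) := by
  unfold Delta
  rw [← Finset.sum_range_reflect, Finset.mul_sum]
  refine Finset.sum_congr rfl fun k hk => ?_
  have hk' : k ≤ m := by simpa [Nat.lt_succ_iff] using hk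
  have e : m + 1 - 1 - k = m - k := by omega
  rw [e, Nat.choose_symm hk', Nat.cast_sub hk']
  have : (-1 : ℝ) ^ (m - k) = (-1) ^ m * (-1) ^ k := by
    obtain ⟨j, rfl⟩ := Nat.exists_eq_add_of_le hk'
    rw [Nat.add_sub_cancel_left, pow_add]
    have : ((-1:ℝ) ^ k) * (-1) ^ k = 1 := by rw [← mul_pow]; simp
    linear_combination (-(-1:ℝ) ^ j) * this
  rw [this]
  ring_nf

lemma Delta_zero {m : ℕ} (hm : 1 ≤ m) (F : ℝ → ℝ) : Delta m 0 F = 0 := by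
  rw [Delta_eq_iter]
  obtain ⟨j, rfl⟩ := Nat.exists_eq_add_of_le hm
  rw [add_comm, Function.iterate_succ_apply]
  have : fwdDiff (0:ℝ) F = 0 := by funext x; simp [fwdDiff]
  rw [this]
  clear hm
  induction j with
  | zero => rfl
  | succ j ih =>
    rw [Function.iterate_succ_apply]
    have : fwdDiff (0:ℝ) (0 : ℝ → ℝ) = 0 := by funext x; simp [fwdDiff]
    rw [this, ih]

lemma comb_le {p : ℝ} (hp : 1 ≤ p) (ρ : Measure ℝ) {ι : Type} (t : Finset ι) (c : ι → ℝ)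
    (F : ι → ℝ → ℝ) (hF : ∀ i ∈ t, Measurable (F i)) (B : ENNReal)
    (hB : ∀ i ∈ t, eLpNorm (F i) (ENNReal.ofReal p) ρ ≤ B) :
    eLpNorm (fun x => ∑ i ∈ t, c i * F i x) (ENNReal.ofReal p) ρ ≤
      ENNReal.ofReal (∑ i ∈ t, |c i|) * B := by
  have e : (fun x => ∑ i ∈ t, c i * F i x) = ∑ i ∈ t, c i • F i := by
    funext x; simp
  rw [e]
  refine (eLpNorm_sum_le (fun i hi => ((hF i hi).const_smul _).aestronglyMeasurable)
    (by simpa using hp)).trans ?_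
  rw [ENNReal.ofReal_sum_of_nonneg (fun _ _ => abs_nonneg _), Finset.sum_mul]
  refine Finset.sum_le_sum fun i hi => ?_
  rw [eLpNorm_const_smul, ← ofReal_norm, Real.norm_eq_abs]
  gcongr
  exact hB i hi

lemma memLp_eLp {p : ℝ} (hp : 1 ≤ p) {f : ℝ → ℝ} (hf : MemLpT p f) :
    eLpNorm f (ENNReal.ofReal p) VV < ⊤ := by
  obtain ⟨-, h2, h3⟩ := hf
  rw [eLp_eq hp]
  refine ENNReal.rpow_lt_top_of_nonneg (by positivity) ?_
  rw [intervalIntegrable_iff_integrableOn_Ioc_of_le zero_le_one] at h3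
  have := h3.2
  rw [hasFiniteIntegral_iff_ofReal (Eventually.of_forall fun x => by positivity)] at this
  simp only [abs_rpow_ofReal hp] at this
  exact this.ne

lemma eLp_mem {p : ℝ} (hp : 1 ≤ p) {f : ℝ → ℝ} (hper : Function.Periodic f 1) (hm : Measurable f)
    (h : eLpNorm f (ENNReal.ofReal p) VV < ⊤) : MemLpT p f := by
  refine ⟨hper, hm, ?_⟩
  rw [intervalIntegrable_iff_integrableOn_Ioc_of_le zero_le_one]
  refine ⟨(abs_pow_meas p hm).aestronglyMeasurable, ?_⟩
  rw [hasFiniteIntegral_iff_ofReal (Eventually.of_forall fun x => by positivity)]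
  simp only [abs_rpow_ofReal hp]
  rw [eLp_eq hp] at h
  have hp0 : 0 < p := by linarith
  have := (ENNReal.rpow_lt_top_iff_of_pos (by positivity)).1 h
  exact this

lemma mem_LI {p : ℝ} (hp : 1 ≤ p) {f : ℝ → ℝ} (hf : MemLpT p f) (a b : ℝ) :
    IntervalIntegrable f volume a b := by
  refine hf.1.intervalIntegrable one_ne_zero (t := 0) ?_ a b
  rw [zero_add, intervalIntegrable_iff_integrableOn_Ioc_of_le zero_le_one]
  have h : MemLp f (ENNReal.ofReal p) VV := ⟨hf.2.1.aestronglyMeasurable, memLp_eLp hp hf⟩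
  exact h.integrable (by simpa using hp)

lemma Delta_eLp {p : ℝ} (hp : 1 ≤ p) (s : ℕ) {f : ℝ → ℝ} (hf : MemLpT p f) (h : ℝ) :
    eLpNorm (Delta s h f) (ENNReal.ofReal p) VV ≤
      ENNReal.ofReal (∑ ν ∈ Finset.range (s + 1), |(-1 : ℝ) ^ ν * (s.choose ν : ℝ)|) *
        eLpNorm f (ENNReal.ofReal p) VV :=
  comb_le hp VV (Finset.range (s + 1)) (fun ν => (-1 : ℝ) ^ ν * (s.choose ν : ℝ))
    (fun ν x => f (x + ((s : ℝ) - (ν : ℝ)) * h))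
    (fun _ _ => hf.2.1.comp (measurable_id.add_const _)) _
    (fun _ _ => (shift_eLp hp hf.1 _).le)

lemma omega_nonneg (s : ℕ) (p : ℝ) (f : ℝ → ℝ) (δ : ℝ) : 0 ≤ omegaMod s p f δ := by
  refine Real.sSup_nonneg ?_
  rintro y ⟨h, -, -, rfl⟩
  unfold LpNorm
  exact Real.rpow_nonneg (intervalIntegral.integral_nonneg zero_le_one fun x _ => by positivity) _

lemma Delta_le_omega {p : ℝ} (hp : 1 ≤ p) {s : ℕ} (hs : 1 ≤ s) {f : ℝ → ℝ} (hf : MemLpT p f)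
    {δ τ : ℝ} (hτ : |τ| < δ) :
    eLpNorm (Delta s τ f) (ENNReal.ofReal p) VV ≤ ENNReal.ofReal (omegaMod s p f δ) := by
  have pos : ∀ τ, 0 < τ → τ < δ →
      eLpNorm (Delta s τ f) (ENNReal.ofReal p) VV ≤ ENNReal.ofReal (omegaMod s p f δ) := by
    intro τ h0 h1
    have hfin : ∀ h, eLpNorm (Delta s h f) (ENNReal.ofReal p) VV ≠ ⊤ := fun h =>
      ne_top_of_le_ne_top (ENNReal.mul_ne_top ENNReal.ofReal_ne_top (memLp_eLp hp hf).ne)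
        (Delta_eLp hp s hf h)
    rw [← ENNReal.ofReal_toReal (hfin τ), ← LpNorm_eq hp (Delta_meas s τ hf.2.1)]
    refine ENNReal.ofReal_le_ofReal (le_csSup ?_ ⟨τ, h0, h1, rfl⟩)
    refine ⟨(ENNReal.ofReal (∑ ν ∈ Finset.range (s + 1), |(-1 : ℝ) ^ ν * (s.choose ν : ℝ)|) *
        eLpNorm f (ENNReal.ofReal p) VV).toReal, ?_⟩
    rintro y ⟨h, -, -, rfl⟩
    rw [LpNorm_eq hp (Delta_meas s h hf.2.1)]
    exact ENNReal.toReal_mono (ENNReal.mul_ne_top ENNReal.ofReal_ne_top (memLp_eLp hp hf).ne)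
        (Delta_eLp hp s hf h)
  rcases lt_trichotomy τ 0 with h | h | h
  · have e : Delta s τ f = ((-1 : ℝ) ^ s) • fun x => Delta s (-τ) f (x + (-(s * (-τ)))) := by
      funext x
      have := Delta_neg s (-τ) f x
      simpa using this
    rw [e, eLpNorm_const_smul, shift_eLp hp (Delta_per s _ hf.1)]
    have := pos (-τ) (by linarith) (by rwa [abs_of_neg h] at hτ)
    simpa using this
  · subst h
    rw [Delta_zero hs]; simp
  · exact pos τ h (by rwa [abs_of_pos h] at hτ)

noncomputable def avgOp (a : ℝ) (F : ℝ → ℝ) (x : ℝ) : ℝ := ∫ u, F (x + a * u) ∂VV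

lemma LI_affine {f : ℝ → ℝ} (hf : ∀ a b, IntervalIntegrable f volume a b) {a : ℝ} (ha : 0 < a)
    (x α β : ℝ) : IntervalIntegrable (fun t => f (x + a * t)) volume α β := by
  have h1 : IntervalIntegrable (fun t => f (x + t)) volume (a * α) (a * β) := by
    have := (hf (x + a * α) (x + a * β)).comp_add_left x
    simpa using this
  have := h1.comp_mul_left (c := a)
  simpa [ha.ne'] using this

lemma exists_mu (m : ℕ) : ∃ μ : Measure ℝ, IsProbabilityMeasure μ ∧
    μ ≤ volume.restrict (Set.Ioc 0 ((m:ℝ) + 1)) ∧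
    ∀ f : ℝ → ℝ, Measurable f → (∀ a b, IntervalIntegrable f volume a b) → ∀ a : ℝ, 0 < a → ∀ x,
      (avgOp a)^[m + 1] f x = ∫ t, f (x + a * t) ∂μ := by
  induction m with
  | zero =>
    refine ⟨VV, inferInstance, by simp [VV], fun f _ _ a _ x => ?_⟩
    rfl
  | succ m ih =>
    obtain ⟨μ, h1, h2, h3⟩ := ih
    have hle : VV ∗ μ ≤ volume.restrict (Set.Ioc 0 (((m + 1 : ℕ):ℝ) + 1)) := by
      refine Measure.le_iff.2 fun S hS => ?_
      rw [Measure.restrict_apply hS, ← lintegral_indicator_one hS, ← lintegral_indicator_one (hS.inter measurableSet_Ioc),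
        Measure.conv_comm,
        Measure.lintegral_conv (measurable_one.indicator hS)]
      have hmem : ∀ᵐ t ∂μ, t ∈ Set.Ioc 0 ((m:ℝ) + 1) :=
        (ae_restrict_mem measurableSet_Ioc).filter_mono (ae_mono h2)
      set T := S ∩ Set.Ioc 0 (((m + 1 : ℕ):ℝ) + 1) with hT
      calc _ ≤ ∫⁻ t, ∫⁻ z, T.indicator (1 : ℝ → ENNReal) z ∂volume ∂μ := ?_
        _ = _ := by simp
      refine lintegral_mono_ae ?_
      filter_upwards [hmem] with t ht
      calc _ ≤ ∫⁻ y, T.indicator (1 : ℝ → ENNReal) (t + y) ∂VV := ?_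
        _ ≤ ∫⁻ y, T.indicator (1 : ℝ → ENNReal) (t + y) :=
          lintegral_mono' Measure.restrict_le_self le_rfl
        _ = _ := lintegral_add_left_eq_self _ t
      refine lintegral_mono_ae ?_
      have : ∀ᵐ y ∂VV, y ∈ Set.Ioc (0:ℝ) 1 := ae_restrict_mem measurableSet_Ioc
      filter_upwards [this] with y hy
      by_cases hS' : t + y ∈ S
      · have : t + y ∈ T := ⟨hS', by linarith [ht.1, hy.1], by
          push_cast; linarith [ht.2, hy.2]⟩
        simp [this, hS']
      · simp [hS']
    refine ⟨VV ∗ μ, inferInstance, hle, fun f hm hf a ha x => ?_⟩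
    have hInteg : Integrable (fun t => f (x + a * t)) (VV ∗ μ) := by
      refine Integrable.mono_measure ?_ hle
      have := LI_affine hf ha x 0 (((m + 1 : ℕ):ℝ) + 1)
      rwa [intervalIntegrable_iff_integrableOn_Ioc_of_le (by positivity)] at this
    rw [integral_conv hInteg, Function.iterate_succ_apply', avgOp]
    refine integral_congr_ae (Eventually.of_forall fun u => ?_)
    simp only
    rw [h3 f hm hf a ha]
    simp only [mul_add, add_assoc]

lemma avgOp_eq {a : ℝ} (ha : 0 < a) (F : ℝ → ℝ) (x : ℝ) :
    avgOp a F x = a⁻¹ * ∫ t in x..(x + a), F t := by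
  have h : avgOp a F x = ∫ u in (0:ℝ)..1, F (x + a * u) := by
    rw [intervalIntegral.integral_of_le zero_le_one]; rfl
  rw [h, intervalIntegral.integral_comp_add_mul _ ha.ne']
  simp

lemma avgOp_eq' {a : ℝ} (ha : 0 < a) {F : ℝ → ℝ} (hF : ∀ a b, IntervalIntegrable F volume a b) :
    avgOp a F = fun x => a⁻¹ * ((∫ t in (0:ℝ)..(x + a), F t) - ∫ t in (0:ℝ)..x, F t) := by
  funext x
  rw [avgOp_eq ha, intervalIntegral.integral_interval_sub_left (hF _ _) (hF _ _)]

lemma avgOp_cont {a : ℝ} (ha : 0 < a) {F : ℝ → ℝ} (hF : ∀ a b, IntervalIntegrable F volume a b) :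
    Continuous (avgOp a F) := by
  rw [avgOp_eq' ha hF]
  have := intervalIntegral.continuous_primitive hF 0
  fun_prop

lemma avgOp_deriv {a : ℝ} (ha : 0 < a) {F : ℝ → ℝ} (hF : Continuous F) (x : ℝ) :
    HasDerivAt (avgOp a F) (a⁻¹ * (F (x + a) - F x)) x := by
  rw [avgOp_eq' ha fun a b => hF.intervalIntegrable a b]
  have h : ∀ y, HasDerivAt (fun x => ∫ t in (0:ℝ)..x, F t) (F y) y := fun y =>
    intervalIntegral.integral_hasDerivAt_right (hF.intervalIntegrable _ _)
      hF.stronglyMeasurable.stronglyMeasurableAtFilter hF.continuousAt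
  exact (((h (x + a)).comp_add_const x a).sub (h x)).const_mul a⁻¹

lemma avgOp_smooth {a : ℝ} (ha : 0 < a) (j : ℕ) : ∀ {F : ℝ → ℝ}, Continuous F →
    ContDiff ℝ j ((avgOp a)^[j] F) ∧
      iteratedDeriv j ((avgOp a)^[j] F) = fun x => a⁻¹ ^ j * Delta j a F x := by
  induction j with
  | zero =>
    intro F hF
    refine ⟨by simpa using hF, ?_⟩
    funext x
    simp [Delta]
  | succ j ih =>
    intro F hF
    have hc1 : Continuous (avgOp a F) := avgOp_cont ha fun a b => hF.intervalIntegrable a b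
    constructor
    · obtain ⟨h1, -⟩ := ih hF
      rw [Function.iterate_succ_apply']
      have hd := fun x => avgOp_deriv ha h1.continuous x
      rw [show ((j + 1 : ℕ) : WithTop ℕ∞) = (j : WithTop ℕ∞) + 1 by push_cast; rfl,
        contDiff_succ_iff_deriv]
      refine ⟨fun x => (hd x).differentiableAt, by simp, ?_⟩
      rw [funext fun x => (hd x).deriv]
      have h2 : ContDiff ℝ j fun x => (avgOp a)^[j] F (x + a) := h1.comp (by fun_prop)
      fun_prop
    · obtain ⟨-, h2⟩ := ih hc1
      rw [iteratedDeriv_succ, Function.iterate_succ_apply, h2]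
      funext x
      have hD : HasDerivAt (Delta j a (avgOp a F))
          (Delta j a (fun y => a⁻¹ * (F (y + a) - F y)) x) x := by
        unfold Delta
        refine HasDerivAt.fun_sum fun ν _ => ?_
        exact ((avgOp_deriv ha hF _).comp_add_const x _).const_mul _
      rw [(hD.const_mul _).deriv, Delta_add, pow_succ, mul_assoc]
      congr 1
      simp only [Delta_eq_iter j]
      have e : (fun y => a⁻¹ * (F (y + a) - F y)) = a⁻¹ • Delta 1 a F := by
        funext y; simp [Delta_eq_iter, fwdDiff]
      rw [e, fwdDiff_iter_const_smul]
      rfl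

lemma Delta_int (m : ℕ) (τ c b : ℝ) (F : ℝ → ℝ) (μ : Measure ℝ)
    (hi : ∀ x, Integrable (fun u => F (x + b * u)) μ) (x : ℝ) :
    Delta m τ (fun y => ∫ u, F (y + c + b * u) ∂μ) x = ∫ u, Delta m τ F (x + c + b * u) ∂μ := by
  unfold Delta
  rw [integral_finsetSum]
  · refine Finset.sum_congr rfl fun ν _ => ?_
    rw [integral_const_mul]
    refine congrArg _ (integral_congr_ae (Eventually.of_forall fun u => ?_))
    simp only
    congr 1; ring
  · intro ν _
    refine Integrable.const_mul ?_ _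
    have := hi (x + c + ((m:ℝ) - ν) * τ)
    refine this.congr (Eventually.of_forall fun u => ?_)
    simp only
    congr 1; ring

lemma VV_int {F : ℝ → ℝ} (hF : ∀ a b, IntervalIntegrable F volume a b) {b : ℝ} (hb : 0 < b) (x : ℝ) :
    Integrable (fun u => F (x + b * u)) VV := by
  have := LI_affine hF hb x 0 1
  rwa [intervalIntegrable_iff_integrableOn_Ioc_of_le zero_le_one] at this

noncomputable def gfun (s : ℕ) (h : ℝ) (f : ℝ → ℝ) (x : ℝ) : ℝ :=
  ∑ ν ∈ Finset.range s, (-(-1 : ℝ) ^ s * ((-1 : ℝ) ^ ν * (s.choose ν : ℝ))) *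
    (avgOp (((s : ℝ) - ν) * h))^[s + 1] f x

lemma avgOp_per (a : ℝ) {F : ℝ → ℝ} (hF : Function.Periodic F 1) : Function.Periodic (avgOp a F) 1 := by
  intro x
  unfold avgOp
  congr 1
  funext u
  rw [show x + 1 + a * u = x + a * u + 1 by ring, hF]

lemma avgOp_iter_per (a : ℝ) (m : ℕ) : ∀ {F : ℝ → ℝ}, Function.Periodic F 1 →
    Function.Periodic ((avgOp a)^[m] F) 1 := by
  induction m with
  | zero => intro F hF; exact hF
  | succ m ih => intro F hF; rw [Function.iterate_succ_apply]; exact ih (avgOp_per a hF)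

lemma gfun_per (s : ℕ) (h : ℝ) {f : ℝ → ℝ} (hF : Function.Periodic f 1) :
    Function.Periodic (gfun s h f) 1 := by
  intro x
  unfold gfun
  refine Finset.sum_congr rfl fun ν _ => ?_
  rw [avgOp_iter_per _ _ hF]

lemma sub_pos_range {s ν : ℕ} (hν : ν ∈ Finset.range s) : (1 : ℝ) ≤ (s : ℝ) - ν := by
  have : ν + 1 ≤ s := Finset.mem_range.1 hν
  have : (ν : ℝ) + 1 ≤ s := by exact_mod_cast this
  linarith

lemma gfun_smooth (s : ℕ) {h : ℝ} (hh : 0 < h) {f : ℝ → ℝ}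
    (hf : ∀ a b, IntervalIntegrable f volume a b) :
    ContDiff ℝ s (gfun s h f) ∧ iteratedDeriv s (gfun s h f) =
      fun x => ∑ ν ∈ Finset.range s, (-(-1 : ℝ) ^ s * ((-1 : ℝ) ^ ν * (s.choose ν : ℝ)) *
        (((s : ℝ) - ν) * h)⁻¹ ^ s) * ∫ u, Delta s (((s : ℝ) - ν) * h) f (x + ((s : ℝ) - ν) * h * u) ∂VV := by
  have hpos : ∀ ν ∈ Finset.range s, 0 < ((s : ℝ) - ν) * h := fun ν hν => by
    have := sub_pos_range hν
    positivity
  have hsm := fun ν (hν : ν ∈ Finset.range s) =>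
    avgOp_smooth (hpos ν hν) s (avgOp_cont (hpos ν hν) hf)
  have hcd : ∀ ν ∈ Finset.range s, ContDiff ℝ s (fun x =>
      (-(-1 : ℝ) ^ s * ((-1 : ℝ) ^ ν * (s.choose ν : ℝ))) *
        (avgOp (((s : ℝ) - ν) * h))^[s + 1] f x) := fun ν hν => by
    have := (hsm ν hν).1
    rw [← Function.iterate_succ_apply] at this
    exact contDiff_const.mul this
  refine ⟨ContDiff.sum hcd, ?_⟩
  funext x
  unfold gfun
  rw [iteratedDeriv_fun_sum fun ν hν => (hcd ν hν).contDiffAt]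
  refine Finset.sum_congr rfl fun ν hν => ?_
  rw [iteratedDeriv_const_mul_field, Function.iterate_succ_apply, (hsm ν hν).2]
  simp only
  rw [← mul_assoc]
  congr 1
  have := Delta_int s (((s : ℝ) - ν) * h) 0 (((s : ℝ) - ν) * h) f VV (VV_int hf (hpos ν hν)) x
  simp only [add_zero] at this
  exact this

lemma meas_shift_int {F : ℝ → ℝ} (hF : Measurable F) (μ : Measure ℝ) [SFinite μ] (c b : ℝ) :
    Measurable fun x => ∫ u, F (x + c + b * u) ∂μ := by
  have h : Measurable (Function.uncurry fun x u : ℝ => F (x + c + b * u)) :=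
    hF.comp (by fun_prop)
  exact (h.stronglyMeasurable.integral_prod_right).measurable

lemma mu_int {β : ℝ} (hβ : 0 ≤ β) {μ : Measure ℝ} (hμ : μ ≤ volume.restrict (Set.Ioc 0 β))
    {F : ℝ → ℝ} (hF : ∀ a b, IntervalIntegrable F volume a b) {b : ℝ} (hb : 0 < b) (x : ℝ) :
    Integrable (fun u => F (x + b * u)) μ := by
  refine Integrable.mono_measure ?_ hμ
  have := LI_affine hF hb x 0 β
  rwa [intervalIntegrable_iff_integrableOn_Ioc_of_le hβ] at this

lemma node_bound {p γ : ℝ} (hp : 1 ≤ p) {X : ℕ → ℕ → ℝ} (hX : NodesOK γ X) {n : ℕ} (hn : 1 ≤ n)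
    (hγ : 0 < γ) {F : ℝ → ℝ} (hF : Measurable F) (hper : Function.Periodic F 1) {b β : ℝ} (hb : 0 < b)
    (c : ℝ) {μ : Measure ℝ} [IsProbabilityMeasure μ] (hμ : μ ≤ volume.restrict (Set.Ioc 0 β))
    (hL : b * β ≤ γ / n) :
    eLpNorm (fun x => ∫ u, F (x + c + b * u) ∂μ) (ENNReal.ofReal p) (nodeM n (X n)) ≤
      ENNReal.ofReal (1 / b) ^ (1 / p) * eLpNorm F (ENNReal.ofReal p) VV := by
  have hK : Measurable (Function.uncurry fun x u : ℝ => F (x + c + b * u)) :=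
    hF.comp (by fun_prop)
  refine (mink_pow hp _ μ hK).trans ?_
  rw [eLp_eq hp, ← ENNReal.mul_rpow_of_nonneg _ _ (by positivity)]
  refine ENNReal.rpow_le_rpow ?_ (by positivity)
  have hm : Measurable fun y => ‖F y‖ₑ ^ p := by fun_prop
  calc _ ≤ ∫⁻ u in Set.Ioc 0 β, ∫⁻ x, ‖F (x + c + b * u)‖ₑ ^ p ∂(nodeM n (X n)) :=
        lintegral_mono' hμ le_rfl
    _ = ∫⁻ u in Set.Ioc 0 β, ∑ k ∈ Finset.range n, ‖F (X n k + c + b * u)‖ₑ ^ p := by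
        simp only [nodeM, lintegral_finsetSum_measure, lintegral_dirac]
    _ = ∑ k ∈ Finset.range n, ∫⁻ u in Set.Ioc 0 β, ‖F (X n k + c + b * u)‖ₑ ^ p :=
        lintegral_finsetSum _ fun k _ => hm.comp (by fun_prop)
    _ ≤ _ := node_avg hX hn hγ (H := fun y => ‖F y‖ₑ ^ p) (fun x => by simp only [hper x]) hb c 0 β
        (by simpa using hL)

lemma sub_gfun {s : ℕ} {h : ℝ} (hh : 0 < h) {f : ℝ → ℝ} (hm : Measurable f)
    (hf : ∀ a b, IntervalIntegrable f volume a b) {μ : Measure ℝ} [IsProbabilityMeasure μ]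
    (hμ : μ ≤ volume.restrict (Set.Ioc 0 ((s:ℝ) + 1)))
    (hrep : ∀ f : ℝ → ℝ, Measurable f → (∀ a b, IntervalIntegrable f volume a b) →
      ∀ a : ℝ, 0 < a → ∀ x, (avgOp a)^[s + 1] f x = ∫ t, f (x + a * t) ∂μ) (x : ℝ) :
    f x - gfun s h f x = (-1) ^ s * ∫ t, Delta s (h * t) f x ∂μ := by
  have hi : ∀ ν ∈ Finset.range s, Integrable (fun t => f (x + ((s:ℝ) - ν) * (h * t))) μ := by
    intro ν hν
    have hpos : 0 < ((s : ℝ) - ν) * h := by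
      have := sub_pos_range hν
      positivity
    have := mu_int (by positivity) hμ hf hpos x
    simpa only [mul_assoc] using this
  have hD : ∫ t, Delta s (h * t) f x ∂μ = ∑ ν ∈ Finset.range s, ((-1 : ℝ) ^ ν * (s.choose ν : ℝ)) *
      (avgOp (((s : ℝ) - ν) * h))^[s + 1] f x + (-1) ^ s * f x := by
    unfold Delta
    simp only [Finset.sum_range_succ, sub_self, zero_mul, add_zero, Nat.choose_self, Nat.cast_one, mul_one]
    rw [integral_add (integrable_finsetSum _ fun ν hν => (hi ν hν).const_mul _) (integrable_const _),
      integral_finsetSum _ fun ν hν => (hi ν hν).const_mul _]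
    simp only [integral_const, probReal_univ, one_smul]
    congr 1
    refine Finset.sum_congr rfl fun ν hν => ?_
    have hpos : 0 < ((s : ℝ) - ν) * h := by
      have := sub_pos_range hν
      positivity
    rw [integral_const_mul, hrep f hm hf _ hpos]
    simp only [mul_assoc]
  rw [hD, gfun, mul_add, ← mul_assoc, ← mul_pow, Finset.mul_sum]
  have : ∀ A B : ℕ → ℝ, (∀ ν, A ν = - B ν) → f x - ∑ ν ∈ Finset.range s, A ν =
    ∑ ν ∈ Finset.range s, B ν + ((-1) * (-1)) ^ s * f x := by
    intro A B h
    simp [h]; ring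
  exact this _ _ fun ν => by ring

noncomputable def tav (F : ℝ → ℝ) (x c : ℝ) : ℝ := ∫ u, F (x + c * (u - 1 / 2)) ∂VV

lemma tav_neg (F : ℝ → ℝ) (x c : ℝ) : tav F x (-c) = tav F x c := by
  unfold tav VV
  rw [← intervalIntegral.integral_of_le zero_le_one, ← intervalIntegral.integral_of_le zero_le_one]
  have := intervalIntegral.integral_comp_sub_left (a := 0) (b := 1)
    (fun u : ℝ => F (x + c * (u - 1 / 2))) 1
  simp only [sub_self, sub_zero] at this
  rw [← this]
  congr 1
  funext u
  congr 1; ring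

lemma tav_int {F : ℝ → ℝ} (hF : ∀ a b, IntervalIntegrable F volume a b) {c : ℝ} (hc : 0 < c) (x : ℝ) :
    Integrable (fun u => F (x + c * (u - 1 / 2))) VV := by
  have := VV_int hF hc (x - c / 2)
  refine this.congr (Eventually.of_forall fun u => ?_)
  simp only
  congr 1; ring

lemma tav_int_neg {F : ℝ → ℝ} (hF : ∀ a b, IntervalIntegrable F volume a b) {c : ℝ} (hc : 0 < c) (x : ℝ) :
    Integrable (fun u => F (x + (-c) * (u - 1 / 2))) VV := by
  have h := LI_affine hF hc (x - c / 2) 0 1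
  have h2 := h.comp_sub_left 1
  simp only [sub_self, sub_zero] at h2
  have h3 := h2.symm
  rw [intervalIntegrable_iff_integrableOn_Ioc_of_le zero_le_one] at h3
  refine Integrable.congr (μ := VV) h3 (Eventually.of_forall fun u => ?_)
  simp only
  congr 1; ring

lemma steklov_eq {r : ℕ} (hr : 1 ≤ r) {δ : ℝ} (hδ : 0 < δ) {F : ℝ → ℝ}
    (hF : ∀ a b, IntervalIntegrable F volume a b) (x : ℝ) :
    steklov r δ F x = ∑ ν ∈ Finset.range r, ((-1 : ℝ) ^ (r + 1) * (((2 * r).choose r : ℝ))⁻¹ * 2 *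
      ((-1 : ℝ) ^ ν * ((2 * r).choose ν : ℝ))) * tav F x (((r : ℝ) - ν) / r * δ) := by
  have hr0 : (0:ℝ) < r := by exact_mod_cast hr
  have hc : ∀ ν ∈ Finset.range r, 0 < ((r : ℝ) - ν) / r * δ := fun ν hν => by
    have := sub_pos_range hν
    positivity
  unfold steklov
  have hsub : ∀ Φ : ℝ → ℝ, ∫ t in (-(δ / 2))..(δ / 2), Φ t = δ * ∫ u, Φ (δ * (u - 1 / 2)) ∂VV := by
    intro Φ
    have := intervalIntegral.integral_comp_add_mul (a := 0) (b := 1) Φ hδ.ne' (-(δ / 2))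
    rw [VV, ← intervalIntegral.integral_of_le zero_le_one]
    have e : (fun u : ℝ => Φ (δ * (u - 1 / 2))) = fun u => Φ (-(δ / 2) + δ * u) := by
      funext u; congr 1; ring
    rw [e, this]
    simp only [smul_eq_mul]
    rw [← mul_assoc, mul_inv_cancel₀ hδ.ne', one_mul]
    congr 1 <;> ring
  rw [hsub, integral_finsetSum, ← mul_assoc,
    show (-1 : ℝ) ^ (r + 1) * (((2 * r).choose r : ℝ))⁻¹ * (2 / δ) * δ =
      (-1 : ℝ) ^ (r + 1) * (((2 * r).choose r : ℝ))⁻¹ * 2 by field_simp, Finset.mul_sum]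
  · refine Finset.sum_congr rfl fun ν _ => ?_
    rw [integral_const_mul, tav]
    simp only [mul_assoc]
  · intro ν hν
    have := tav_int hF (hc ν hν) x
    refine Integrable.const_mul ?_ _
    simpa only [mul_assoc] using this

lemma steklov_sub {r : ℕ} (hr : 1 ≤ r) {δ : ℝ} (hδ : 0 < δ) {F : ℝ → ℝ}
    (hF : ∀ a b, IntervalIntegrable F volume a b) (x : ℝ) :
    steklov r δ F x - F x = (-1 : ℝ) ^ (r + 1) * (((2 * r).choose r : ℝ))⁻¹ *
      ∫ u, Delta (2 * r) (δ * (u - 1 / 2) / r) F (x + (-(δ * (u - 1 / 2)))) ∂VV := by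
  have hr0 : (0:ℝ) < r := by exact_mod_cast hr
  have hc : ∀ ν ∈ Finset.range r, 0 < ((r : ℝ) - ν) / r * δ := fun ν hν => by
    have := sub_pos_range hν
    positivity
  have hch : ((2 * r).choose r : ℝ) ≠ 0 := by
    have := Nat.choose_pos (show r ≤ 2 * r by omega)
    positivity
  rw [steklov_eq hr hδ hF]
  have hI : ∀ ν ∈ Finset.range (2 * r + 1),
      Integrable (fun u => F (x + ((r : ℝ) - ν) / r * δ * (u - 1 / 2))) VV := by
    intro ν hν
    rcases lt_trichotomy ν r with h | h | h
    · exact tav_int hF (hc ν (Finset.mem_range.2 h)) x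
    · subst h; simp
    · have h' : (r : ℝ) < ν := by exact_mod_cast h
      have : 0 < ((ν : ℝ) - r) / r * δ := by
        have : 0 < (ν : ℝ) - r := by linarith
        positivity
      have := tav_int_neg hF this x
      refine this.congr (Eventually.of_forall fun u => ?_)
      simp only
      congr 1; ring
  have hD : ∫ u, Delta (2 * r) (δ * (u - 1 / 2) / r) F (x + (-(δ * (u - 1 / 2)))) ∂VV =
      ∑ ν ∈ Finset.range (2 * r + 1), ((-1 : ℝ) ^ ν * ((2 * r).choose ν : ℝ)) *
        tav F x (((r : ℝ) - ν) / r * δ) := by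
    unfold Delta tav
    simp only [← integral_const_mul]
    rw [← integral_finsetSum _ fun ν hν => (hI ν hν).const_mul _]
    refine integral_congr_ae (Eventually.of_forall fun u => ?_)
    refine Finset.sum_congr rfl fun ν _ => ?_
    congr 2
    push_cast
    field_simp
    ring
  have h0 : tav F x 0 = F x := by simp [tav]
  have hsplit : ∑ ν ∈ Finset.range (2 * r + 1), ((-1 : ℝ) ^ ν * ((2 * r).choose ν : ℝ)) *
        tav F x (((r : ℝ) - ν) / r * δ) =
      2 * ∑ ν ∈ Finset.range r, ((-1 : ℝ) ^ ν * ((2 * r).choose ν : ℝ)) *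
        tav F x (((r : ℝ) - ν) / r * δ) + (-1) ^ r * ((2 * r).choose r : ℝ) * F x := by
    rw [show 2 * r + 1 = (r + 1) + r by omega, Finset.sum_range_add, Finset.sum_range_succ]
    have : ∑ k ∈ Finset.range r, ((-1 : ℝ) ^ (r + 1 + k) * ((2 * r).choose (r + 1 + k) : ℝ)) *
        tav F x (((r : ℝ) - ((r + 1 + k : ℕ) : ℝ)) / r * δ) =
        ∑ ν ∈ Finset.range r, ((-1 : ℝ) ^ ν * ((2 * r).choose ν : ℝ)) *
        tav F x (((r : ℝ) - ν) / r * δ) := by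
      rw [← Finset.sum_range_reflect]
      refine Finset.sum_congr rfl fun ν hν => ?_
      have hν' := Finset.mem_range.1 hν
      have e : r + 1 + (r - 1 - ν) = 2 * r - ν := by omega
      rw [e, Nat.choose_symm (by omega), ← tav_neg]
      have e2 : (-1 : ℝ) ^ (2 * r - ν) = (-1) ^ ν := by
        have : (-1 : ℝ) ^ (2 * r - ν) * ((-1) ^ ν * (-1) ^ ν) = (-1) ^ (2 * r) * (-1) ^ ν := by
          rw [← mul_assoc, ← pow_add, Nat.sub_add_cancel (by omega)]
        rw [← mul_pow, pow_mul] at this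
        simpa using this
      rw [e2, Nat.cast_sub (by omega)]
      congr 2
      push_cast
      ring
    rw [this, sub_self, zero_div, zero_mul, h0]
    ring
  rw [hD, hsplit]
  have hsg : (-1 : ℝ) ^ (r + 1) * (-1) ^ r = -1 := by
    rw [pow_succ, mul_right_comm, ← mul_pow]; simp
  simp only [mul_assoc, ← Finset.mul_sum]
  have h3 : ((2 * r).choose r : ℝ)⁻¹ * ((2 * r).choose r : ℝ) = 1 := inv_mul_cancel₀ hch
  linear_combination (-((2 * r).choose r : ℝ)⁻¹ * ((2 * r).choose r : ℝ) * F x) * hsg + F x * h3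

lemma gfun_cont (s : ℕ) {h : ℝ} (hh : 0 < h) {f : ℝ → ℝ}
    (hf : ∀ a b, IntervalIntegrable f volume a b) : Continuous (gfun s h f) :=
  (gfun_smooth s hh hf).1.continuous

/-- Estimate (a). -/
lemma est_a {p : ℝ} (hp : 1 ≤ p) {s : ℕ} (hs : 1 ≤ s) {f : ℝ → ℝ} (hf : MemLpT p f) {h δ : ℝ}
    (hh : 0 < h) (hδ : h * (s + 1) < δ) :
    eLpNorm (fun x => f x - gfun s h f x) (ENNReal.ofReal p) VV ≤
      ENNReal.ofReal (omegaMod s p f δ) := by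
  obtain ⟨μ, hμ1, hμ2, hμ3⟩ := exists_mu s
  have e : (fun x => f x - gfun s h f x) =
      ((-1 : ℝ) ^ s) • fun x => ∫ t, Delta s (h * t) f x ∂μ := by
    funext x
    rw [sub_gfun hh hf.2.1 (mem_LI hp hf) hμ2 hμ3]
    rfl
  rw [e, eLpNorm_const_smul]
  simp only [enorm_pow, enorm_neg, enorm_one, one_pow, one_mul]
  have hm : Measurable (Function.uncurry fun x t : ℝ => Delta s (h * t) f x) := by
    have := hf.2.1
    unfold Delta Function.uncurry
    fun_prop
  refine mink_sup hp VV μ hm _ ?_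
  have hmem : ∀ᵐ t ∂μ, t ∈ Set.Ioc 0 ((s:ℝ) + 1) :=
    (ae_restrict_mem measurableSet_Ioc).filter_mono (ae_mono hμ2)
  filter_upwards [hmem] with t ht
  refine Delta_le_omega hp hs hf ?_
  have h0 : 0 < h * t := mul_pos hh ht.1
  rw [abs_of_pos h0]
  have := mul_le_mul_of_nonneg_left ht.2 hh.le
  linarith

/-- Estimate (b). -/
lemma est_b {p : ℝ} (hp : 1 ≤ p) {s : ℕ} (hs : 1 ≤ s) : ∃ C : ℝ, 0 ≤ C ∧ ∀ {f : ℝ → ℝ}, MemLpT p f →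
    ∀ {h δ : ℝ}, 0 < h → h * (s + 1) < δ →
    eLpNorm (iteratedDeriv s (gfun s h f)) (ENNReal.ofReal p) VV ≤
      ENNReal.ofReal (C * h⁻¹ ^ s) * ENNReal.ofReal (omegaMod s p f δ) := by
  refine ⟨∑ ν ∈ Finset.range s, |-(-1 : ℝ) ^ s * ((-1 : ℝ) ^ ν * (s.choose ν : ℝ)) *
        ((s : ℝ) - ν)⁻¹ ^ s|, Finset.sum_nonneg fun _ _ => abs_nonneg _, ?_⟩
  intro f hf h δ hh hδ
  rw [(gfun_smooth s hh (mem_LI hp hf)).2]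
  have hmK : ∀ b : ℝ, Measurable (Function.uncurry fun x u : ℝ => Delta s b f (x + b * u)) :=
    fun b => (Delta_meas s b hf.2.1).comp (by fun_prop)
  refine (comb_le hp VV (Finset.range s) _ _ (fun ν _ => ?_)
    (ENNReal.ofReal (omegaMod s p f δ)) ?_).trans ?_
  · exact ((hmK _).stronglyMeasurable.integral_prod_right).measurable
  · intro ν hν
    have h1 := sub_pos_range hν
    refine mink_sup hp VV VV (hmK _) _ (Eventually.of_forall fun u => ?_)
    rw [shift_eLp hp (Delta_per s _ hf.1)]
    refine Delta_le_omega hp hs hf ?_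
    rw [abs_of_pos (by positivity)]
    have : ((s:ℝ) - ν) * h ≤ s * h := by
      gcongr
      linarith [Nat.cast_nonneg (α := ℝ) ν]
    nlinarith
  · gcongr
    rw [Finset.sum_mul]
    refine Finset.sum_le_sum fun ν _ => ?_
    rw [mul_inv, mul_pow, ← mul_assoc, abs_mul _ (h⁻¹ ^ s), abs_of_pos (a := h⁻¹ ^ s) (by positivity)]

lemma Delta_gfun {s : ℕ} {h : ℝ} (hh : 0 < h) {f : ℝ → ℝ} (hm : Measurable f)
    (hf : ∀ a b, IntervalIntegrable f volume a b) {μ : Measure ℝ} [IsProbabilityMeasure μ]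
    (hμ : μ ≤ volume.restrict (Set.Ioc 0 ((s:ℝ) + 1)))
    (hrep : ∀ f : ℝ → ℝ, Measurable f → (∀ a b, IntervalIntegrable f volume a b) →
      ∀ a : ℝ, 0 < a → ∀ x, (avgOp a)^[s + 1] f x = ∫ t, f (x + a * t) ∂μ) (τ x : ℝ) :
    Delta s τ (gfun s h f) x = ∑ ν ∈ Finset.range s,
      (-(-1 : ℝ) ^ s * ((-1 : ℝ) ^ ν * (s.choose ν : ℝ))) *
        ∫ u, Delta s τ f (x + ((s : ℝ) - ν) * h * u) ∂μ := by
  have e : gfun s h f = ∑ ν ∈ Finset.range s, (-(-1 : ℝ) ^ s * ((-1 : ℝ) ^ ν * (s.choose ν : ℝ))) •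
      fun y => ∫ u, f (y + 0 + ((s : ℝ) - ν) * h * u) ∂μ := by
    funext y
    simp only [gfun, Finset.sum_apply, Pi.smul_apply, smul_eq_mul, add_zero]
    refine Finset.sum_congr rfl fun ν hν => ?_
    have := sub_pos_range hν
    rw [hrep f hm hf _ (by positivity)]
  rw [e, Delta_eq_iter, fwdDiff_iter_finsetSum, Finset.sum_apply]
  refine Finset.sum_congr rfl fun ν hν => ?_
  have h1 := sub_pos_range hν
  rw [fwdDiff_iter_const_smul, ← Delta_eq_iter, Pi.smul_apply, smul_eq_mul,
    Delta_int s τ 0 _ f μ (mu_int (by positivity) hμ hf (by positivity))]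
  simp only [add_zero]

/-- Estimate (c1). -/
lemma est_c1 {p γ : ℝ} (hp : 1 ≤ p) {r s : ℕ} (hr : 1 ≤ r) (hs : 1 ≤ s) (hsr : s ≤ 2 * r)
    {X : ℕ → ℕ → ℝ} (hX : NodesOK γ X) (hγ : 0 < γ) (hγ1 : γ ≤ 1) :
    ∃ C : ℝ, 0 ≤ C ∧ ∀ {f : ℝ → ℝ}, MemLpT p f → ∀ {n : ℕ}, 1 ≤ n → ∀ {h : ℝ}, 0 < h →
      s * h * (s + 1) ≤ γ / n →
      eLpNorm (fun x => steklov r (γ / n) (gfun s h f) x - gfun s h f x) (ENNReal.ofReal p)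
        (nodeM n (X n)) ≤
      ENNReal.ofReal C * (ENNReal.ofReal (1 / h) ^ (1 / p) *
        ENNReal.ofReal (omegaMod s p f (1 / n))) := by
  obtain ⟨μ, hμ1, hμ2, hμ3⟩ := exists_mu s
  set c1 := ∑ ν ∈ Finset.range s, |-(-1 : ℝ) ^ s * ((-1 : ℝ) ^ ν * (s.choose ν : ℝ))| with hc1
  set c2 := ∑ ν ∈ Finset.range (2 * r - s + 1), |(-1 : ℝ) ^ ν * ((2 * r - s).choose ν : ℝ)| with hc2
  set c3 := |(-1 : ℝ) ^ (r + 1) * (((2 * r).choose r : ℝ))⁻¹| with hc3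
  have hc1' : 0 ≤ c1 := Finset.sum_nonneg fun _ _ => abs_nonneg _
  have hc2' : 0 ≤ c2 := Finset.sum_nonneg fun _ _ => abs_nonneg _
  have hc3' : 0 ≤ c3 := abs_nonneg _
  refine ⟨c3 * (c2 * c1), by positivity, ?_⟩
  intro f hf n hn h hh hL
  have hn0 : (0:ℝ) < n := by exact_mod_cast hn
  have hr0 : (1:ℝ) ≤ r := by exact_mod_cast hr
  have hLI := mem_LI hp hf
  have hg := gfun_cont s hh hLI
  have hδ : 0 < γ / n := by positivity
  set B := ENNReal.ofReal (1 / h) ^ (1 / p) * ENNReal.ofReal (omegaMod s p f (1 / n)) with hB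
  have step1 : ∀ τ : ℝ, |τ| < 1 / n → ∀ c : ℝ,
      eLpNorm (fun x => Delta s τ (gfun s h f) (x + c)) (ENNReal.ofReal p) (nodeM n (X n)) ≤
        ENNReal.ofReal c1 * B := by
    intro τ hτ c
    simp only [Delta_gfun hh hf.2.1 hLI hμ2 hμ3]
    refine comb_le hp _ _ _ _ (fun ν _ => meas_shift_int (Delta_meas s τ hf.2.1) μ _ _) _ fun ν hν => ?_
    have h1 := sub_pos_range hν
    have h2 : ((s:ℝ) - ν) * h ≤ s * h := by
      gcongr
      linarith [Nat.cast_nonneg (α := ℝ) ν]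
    refine (node_bound hp hX hn hγ (Delta_meas s τ hf.2.1) (Delta_per s τ hf.1) (by positivity) c hμ2
      ?_).trans ?_
    · refine le_trans ?_ hL
      gcongr
    · rw [hB]
      gcongr
      · nlinarith
      · exact Delta_le_omega hp hs hf hτ
  have step2 : ∀ τ : ℝ, |τ| < 1 / n → ∀ c : ℝ,
      eLpNorm (fun x => Delta (2 * r) τ (gfun s h f) (x + c)) (ENNReal.ofReal p) (nodeM n (X n)) ≤
        ENNReal.ofReal c2 * (ENNReal.ofReal c1 * B) := by
    intro τ hτ c
    rw [show 2 * r = (2 * r - s) + s by omega]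
    simp only [Delta_add]
    refine comb_le hp _ (Finset.range (2 * r - s + 1)) _
      (fun ν x => Delta s τ (gfun s h f) (x + c + (((2 * r - s : ℕ) : ℝ) - ν) * τ))
      (fun ν _ => (Delta_meas s τ hg.measurable).comp (by fun_prop)) _ fun ν hν => ?_
    simp only [add_assoc]
    exact step1 τ hτ _
  have e : (fun x => steklov r (γ / n) (gfun s h f) x - gfun s h f x) =
      ((-1 : ℝ) ^ (r + 1) * (((2 * r).choose r : ℝ))⁻¹) • fun x =>
      ∫ u, Delta (2 * r) (γ / n * (u - 1 / 2) / r) (gfun s h f) (x + (-(γ / n * (u - 1 / 2)))) ∂VV := by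
    funext x
    rw [steklov_sub hr hδ fun a b => hg.intervalIntegrable a b]
    rfl
  rw [e, eLpNorm_const_smul, ← ofReal_norm, Real.norm_eq_abs, ← hc3, ENNReal.ofReal_mul hc3',
    ENNReal.ofReal_mul hc2', mul_assoc, mul_assoc]
  gcongr
  have hgm := hg.measurable
  refine mink_sup hp _ VV ?_ _ ?_
  · unfold Delta Function.uncurry
    fun_prop
  · have : ∀ᵐ y ∂VV, y ∈ Set.Ioc (0:ℝ) 1 := ae_restrict_mem measurableSet_Ioc
    filter_upwards [this] with u hu
    refine step2 _ ?_ _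
    rw [abs_div, abs_mul, abs_of_pos hδ, abs_of_pos (show (0:ℝ) < r by linarith)]
    have h1 : |u - 1 / 2| ≤ 1 / 2 := abs_le.2 ⟨by linarith [hu.1], by linarith [hu.2]⟩
    have h2 : γ / n ≤ 1 / n := by gcongr
    have h3 : 0 < 1 / (n:ℝ) := by positivity
    rw [div_lt_iff₀ (by linarith)]
    calc γ / n * |u - 1 / 2| ≤ 1 / n * (1 / 2) := by gcongr
      _ < 1 / n * 1 := by gcongr; norm_num
      _ ≤ 1 / n * r := by gcongr

lemma tav_eq (F : ℝ → ℝ) (x c : ℝ) : tav F x c = ∫ u, F (x + (-(c / 2)) + c * u) ∂VV := by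
  unfold tav
  congr 1
  funext u
  congr 1; ring

lemma tav_meas {F : ℝ → ℝ} (hF : Measurable F) (c : ℝ) : Measurable fun x => tav F x c := by
  simp only [tav_eq]
  exact meas_shift_int hF VV _ _

/-- Estimate (c2). -/
lemma est_c2 {p γ : ℝ} (hp : 1 ≤ p) {r : ℕ} (hr : 1 ≤ r)
    {X : ℕ → ℕ → ℝ} (hX : NodesOK γ X) (hγ : 0 < γ) :
    ∃ C : ℝ, 0 ≤ C ∧ ∀ {F : ℝ → ℝ}, MemLpT p F → ∀ {n : ℕ}, 1 ≤ n →
      eLpNorm (steklov r (γ / n) F) (ENNReal.ofReal p) (nodeM n (X n)) ≤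
      ENNReal.ofReal C * (ENNReal.ofReal (r / (γ / n)) ^ (1 / p) *
        eLpNorm F (ENNReal.ofReal p) VV) := by
  refine ⟨∑ ν ∈ Finset.range r, |(-1 : ℝ) ^ (r + 1) * (((2 * r).choose r : ℝ))⁻¹ * 2 *
      ((-1 : ℝ) ^ ν * ((2 * r).choose ν : ℝ))|, Finset.sum_nonneg fun _ _ => abs_nonneg _, ?_⟩
  intro F hF n hn
  have hn0 : (0:ℝ) < n := by exact_mod_cast hn
  have hr0 : (1:ℝ) ≤ r := by exact_mod_cast hr
  have hδ : 0 < γ / n := by positivity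
  have e : steklov r (γ / n) F = fun x => ∑ ν ∈ Finset.range r, ((-1 : ℝ) ^ (r + 1) *
      (((2 * r).choose r : ℝ))⁻¹ * 2 * ((-1 : ℝ) ^ ν * ((2 * r).choose ν : ℝ))) *
      tav F x (((r : ℝ) - ν) / r * (γ / n)) :=
    funext fun x => steklov_eq hr hδ (mem_LI hp hF) x
  rw [e]
  refine comb_le hp _ (Finset.range r) (fun ν => (-1 : ℝ) ^ (r + 1) *
      (((2 * r).choose r : ℝ))⁻¹ * 2 * ((-1 : ℝ) ^ ν * ((2 * r).choose ν : ℝ))) (fun ν x => tav F x (((r : ℝ) - ν) / r * (γ / n)))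
    (fun ν _ => tav_meas hF.2.1 _) _ fun ν hν => ?_
  have h1 := sub_pos_range hν
  have h2 : ((r:ℝ) - ν) / r ≤ 1 := by
    rw [div_le_one (by linarith)]
    linarith [Nat.cast_nonneg (α := ℝ) ν]
  have h3 : 1 / (r:ℝ) ≤ ((r:ℝ) - ν) / r := by gcongr
  have h4 : 0 < ((r:ℝ) - ν) / r := by positivity
  simp only [tav_eq]
  have hV : VV ≤ volume.restrict (Set.Ioc 0 1) := le_rfl
  refine (node_bound hp hX hn hγ hF.2.1 hF.1 (b := ((r:ℝ) - ν) / r * (γ / n)) (mul_pos h4 hδ) _ hV ?_).trans ?_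
  · rw [mul_one]
    exact mul_le_of_le_one_left hδ.le h2
  · have h5 : 1 / (((r:ℝ) - ν) / r * (γ / n)) ≤ r / (γ / n) := by
      calc 1 / (((r:ℝ) - ν) / r * (γ / n)) ≤ 1 / (1 / r * (γ / n)) := by gcongr
        _ = r / (γ / n) := by field_simp
    exact mul_le_mul_left (ENNReal.rpow_le_rpow (ENNReal.ofReal_le_ofReal h5) (by positivity)) _


lemma cont_mem {p : ℝ} (hp : 1 ≤ p) {F : ℝ → ℝ} (hc : Continuous F) (hper : Function.Periodic F 1) :
    MemLpT p F :=
  ⟨hper, hc.measurable, (hc.abs.rpow_const fun _ => Or.inr (by linarith)).intervalIntegrable _ _⟩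

lemma tav_cont {F : ℝ → ℝ} (hF : ∀ a b, IntervalIntegrable F volume a b) {c : ℝ} (hc : 0 < c) :
    Continuous fun x => tav F x c := by
  have : (fun x => tav F x c) = fun x => avgOp c F (x + (-(c / 2))) := by
    funext x; rw [tav_eq]; rfl
  rw [this]
  exact (avgOp_cont hc hF).comp (by fun_prop)

lemma steklov_mem {p : ℝ} (hp : 1 ≤ p) {r : ℕ} (hr : 1 ≤ r) {δ : ℝ} (hδ : 0 < δ) {F : ℝ → ℝ}
    (hF : MemLpT p F) : MemLpT p (steklov r δ F) := by
  have hr0 : (0:ℝ) < r := by exact_mod_cast hr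
  refine cont_mem hp ?_ ?_
  · rw [funext fun x => steklov_eq hr hδ (mem_LI hp hF) x]
    refine continuous_finsetSum _ fun ν hν => continuous_const.mul (tav_cont (mem_LI hp hF) ?_)
    have := sub_pos_range hν
    positivity
  · intro x
    unfold steklov
    have : ∀ y, F (x + 1 + y) = F (x + y) := fun y => by
      rw [show x + 1 + y = x + y + 1 by ring, hF.1]
    simp only [this]

lemma steklov_add {r : ℕ} (hr : 1 ≤ r) {δ : ℝ} (hδ : 0 < δ) {f g : ℝ → ℝ}
    (hf : ∀ a b, IntervalIntegrable f volume a b) (hg : ∀ a b, IntervalIntegrable g volume a b) (x : ℝ) :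
    steklov r δ f x = steklov r δ g x + steklov r δ (fun y => f y - g y) x := by
  have hr0 : (0:ℝ) < r := by exact_mod_cast hr
  rw [steklov_eq hr hδ hf, steklov_eq hr hδ hg, steklov_eq hr hδ fun a b => (hf a b).sub (hg a b),
    ← Finset.sum_add_distrib]
  refine Finset.sum_congr rfl fun ν hν => ?_
  rw [← mul_add]
  congr 1
  have h1 : 0 < ((r : ℝ) - ν) / r * δ := by
    have := sub_pos_range hν
    positivity
  unfold tav
  rw [integral_sub (tav_int hf h1 x) (tav_int hg h1 x)]
  ring

lemma mem_sub {p : ℝ} (hp : 1 ≤ p) {f g : ℝ → ℝ} (hf : MemLpT p f) (hg : MemLpT p g) :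
    MemLpT p (fun x => f x - g x) := by
  refine eLp_mem hp (fun x => by rw [hf.1, hg.1]) (hf.2.1.sub hg.2.1) ?_
  have h1 : MemLp f (ENNReal.ofReal p) VV := ⟨hf.2.1.aestronglyMeasurable, memLp_eLp hp hf⟩
  have h2 : MemLp g (ENNReal.ofReal p) VV := ⟨hg.2.1.aestronglyMeasurable, memLp_eLp hp hg⟩
  exact (h1.sub h2).2

lemma mem_G {p : ℝ} (hp : 1 ≤ p) {X : ℕ → ℕ → ℝ} {φ : ℕ → ℕ → ℝ → ℝ}
    {G : ℕ → (ℝ → ℝ) → ℝ → ℝ} (hG : SamplingForm p X φ G) (n : ℕ) (f : ℝ → ℝ) :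
    MemLpT p (G n f) := by
  have e : G n f = fun x => ∑ k ∈ Finset.range n, f (X n k) * φ n k x := funext fun x => hG.2 n f x
  have hm : ∀ k, Measurable (φ n k) := fun k => (hG.1 n k).2.1
  rw [e]
  refine eLp_mem hp (fun x => ?_) (by fun_prop) ?_
  · refine Finset.sum_congr rfl fun k _ => ?_
    rw [(hG.1 n k).1]
  · have h : ∀ k ∈ Finset.range n, MemLp (fun x => f (X n k) * φ n k x) (ENNReal.ofReal p) VV :=
      fun k _ => MemLp.const_mul ⟨(hm k).aestronglyMeasurable, memLp_eLp hp (hG.1 n k)⟩ _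
    exact (memLp_finsetSum _ h).2

lemma LpNorm_four {p : ℝ} (hp : 1 ≤ p) {A B C D : ℝ → ℝ} (hA : MemLpT p A) (hB : MemLpT p B)
    (hC : MemLpT p C) (hD : MemLpT p D) :
    LpNorm p (fun x => A x - B x - (C x + D x)) ≤
      LpNorm p A + LpNorm p B + (LpNorm p C + LpNorm p D) := by
  have mA := hA.2.1
  have mB := hB.2.1
  have mC := hC.2.1
  have mD := hD.2.1
  have q1 : 1 ≤ ENNReal.ofReal p := by simpa using hp
  have fA := (memLp_eLp hp hA).ne
  have fB := (memLp_eLp hp hB).ne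
  have fC := (memLp_eLp hp hC).ne
  have fD := (memLp_eLp hp hD).ne
  rw [LpNorm_eq hp (by fun_prop), LpNorm_eq hp mA, LpNorm_eq hp mB, LpNorm_eq hp mC, LpNorm_eq hp mD,
    ← ENNReal.toReal_add fA fB, ← ENNReal.toReal_add fC fD,
    ← ENNReal.toReal_add (ENNReal.add_ne_top.2 ⟨fA, fB⟩) (ENNReal.add_ne_top.2 ⟨fC, fD⟩)]
  refine ENNReal.toReal_mono (ENNReal.add_ne_top.2 ⟨ENNReal.add_ne_top.2 ⟨fA, fB⟩,
    ENNReal.add_ne_top.2 ⟨fC, fD⟩⟩) ?_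
  have h1 : eLpNorm (A - B - (C + D)) (ENNReal.ofReal p) VV ≤ _ :=
    eLpNorm_sub_le (mA.sub mB).aestronglyMeasurable (mC.add mD).aestronglyMeasurable q1
  refine h1.trans (add_le_add ?_ ?_)
  · exact eLpNorm_sub_le mA.aestronglyMeasurable mB.aestronglyMeasurable q1
  · exact eLpNorm_add_le mC.aestronglyMeasurable mD.aestronglyMeasurable q1

lemma scale_toReal {p : ℝ} (hp : 1 ≤ p) {C ω y : ℝ} (hC : 0 ≤ C) (hω : 0 ≤ ω) (hy : 0 ≤ y) :
    (ENNReal.ofReal C * (ENNReal.ofReal y ^ (1 / p) * ENNReal.ofReal ω)).toReal =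
      C * (y ^ (1 / p) * ω) := by
  rw [ENNReal.toReal_mul, ENNReal.toReal_mul, ← ENNReal.toReal_rpow, ENNReal.toReal_ofReal hC,
    ENNReal.toReal_ofReal hω, ENNReal.toReal_ofReal hy]

/-- Estimate (c). -/
lemma est_c {p γ : ℝ} (hp : 1 ≤ p) {r s : ℕ} (hr : 1 ≤ r) (hs : 1 ≤ s) (hsr : s ≤ 2 * r)
    {X : ℕ → ℕ → ℝ} (hX : NodesOK γ X) (hγ : 0 < γ) (hγ1 : γ ≤ 1) {c0 : ℝ} (hc0 : 0 < c0)
    (hc : s * c0 * (s + 1) ≤ γ) (hc' : c0 * (s + 1) < 1) :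
    ∃ C : ℝ, 0 ≤ C ∧ ∀ {f : ℝ → ℝ}, MemLpT p f → ∀ {n : ℕ}, 1 ≤ n →
      ellp p n (X n) (fun x => gfun s (c0 / n) f x - steklov r (γ / n) f x) ≤
        C * omegaMod s p f (1 / n) := by
  obtain ⟨C1, hC1, H1⟩ := est_c1 (p := p) hp hr hs hsr hX hγ hγ1
  obtain ⟨C2, hC2, H2⟩ := est_c2 (p := p) hp hr hX hγ
  refine ⟨C1 * (1 / c0) ^ (1 / p) + C2 * (r / γ) ^ (1 / p), by positivity, ?_⟩
  intro f hf n hn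
  have hn0 : (0:ℝ) < n := by exact_mod_cast hn
  have hδ : 0 < γ / n := by positivity
  set h := c0 / n with hh
  have hh0 : 0 < h := by positivity
  have hLI := mem_LI hp hf
  have hg := gfun_cont s hh0 hLI
  have hgm : MemLpT p (gfun s h f) := cont_mem hp hg (gfun_per s h hf.1)
  set ω := omegaMod s p f (1 / n) with hω
  have hω0 : 0 ≤ ω := omega_nonneg _ _ _ _
  have h1 := H1 hf hn hh0 (by
    rw [hh, show s * (c0 / n) * ((s:ℝ) + 1) = s * c0 * (s + 1) / n by ring]
    gcongr)
  have ha := est_a hp hs hf hh0 (δ := 1 / n) (by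
    rw [hh, show c0 / n * ((s:ℝ) + 1) = c0 * (s + 1) / n by ring]
    gcongr)
  have h2 := H2 (mem_sub hp hf hgm) hn
  have e : (fun x => gfun s h f x - steklov r (γ / n) f x) =
      -((fun x => steklov r (γ / n) (gfun s h f) x - gfun s h f x) +
        steklov r (γ / n) (fun y => f y - gfun s h f y)) := by
    funext x
    simp only [Pi.neg_apply, Pi.add_apply]
    rw [steklov_add hr hδ hLI fun a b => hg.intervalIntegrable a b]
    ring
  have hle : eLpNorm (fun x => gfun s h f x - steklov r (γ / n) f x) (ENNReal.ofReal p)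
      (nodeM n (X n)) ≤ ENNReal.ofReal C1 * (ENNReal.ofReal (1 / h) ^ (1 / p) * ENNReal.ofReal ω) +
        ENNReal.ofReal C2 * (ENNReal.ofReal (r / (γ / n)) ^ (1 / p) * ENNReal.ofReal ω) := by
    rw [e, eLpNorm_neg]
    refine (eLpNorm_add_le ?_ ?_ (by simpa using hp)).trans (add_le_add h1 (h2.trans ?_))
    · exact ((steklov_mem hp hr hδ hgm).2.1.sub hg.measurable).aestronglyMeasurable
    · exact (steklov_mem hp hr hδ (mem_sub hp hf hgm)).2.1.aestronglyMeasurable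
    · gcongr
  have hp1 : 0 ≤ 1 / p := by positivity
  have fin : ∀ C y : ℝ, ENNReal.ofReal C * (ENNReal.ofReal y ^ (1 / p) * ENNReal.ofReal ω) ≠ ⊤ :=
    fun C y => ENNReal.mul_ne_top ENNReal.ofReal_ne_top (ENNReal.mul_ne_top
      (ENNReal.rpow_ne_top_of_nonneg hp1 ENNReal.ofReal_ne_top) ENNReal.ofReal_ne_top)
  have hre := ENNReal.toReal_mono (ENNReal.add_ne_top.2 ⟨fin _ _, fin _ _⟩) hle
  rw [ENNReal.toReal_add (fin _ _) (fin _ _), scale_toReal hp hC1 hω0 (by positivity),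
    scale_toReal hp hC2 hω0 (by positivity)] at hre
  rw [ellp_eq hp]
  refine (mul_le_mul_of_nonneg_left hre (by positivity)).trans (le_of_eq ?_)
  have e1 : (1 / (n:ℝ)) ^ (1 / p) * (1 / h) ^ (1 / p) = (1 / c0) ^ (1 / p) := by
    rw [← Real.mul_rpow (by positivity) (by positivity)]
    congr 1
    rw [hh]; field_simp
  have e2 : (1 / (n:ℝ)) ^ (1 / p) * (r / (γ / n)) ^ (1 / p) = (r / γ) ^ (1 / p) := by
    rw [← Real.mul_rpow (by positivity) (by positivity)]
    congr 1
    field_simp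
  rw [← e1, ← e2]
  ring


theorem stmt4 (p γ : ℝ) (r s : ℕ) (X : ℕ → ℕ → ℝ) (φ : ℕ → ℕ → ℝ → ℝ)
    (G : ℕ → (ℝ → ℝ) → ℝ → ℝ)
    (hp : 1 ≤ p) (hr : 1 ≤ r) (hs : 1 ≤ s) (hsr : s ≤ 2 * r)
    (hγ0 : 0 < γ) (hγ1 : γ ≤ 1) (hX : NodesOK γ X) (hGform : SamplingForm p X φ G)
    (K1 : ℝ) (hK1 : 0 < K1) (hc1 : CondC1 p K1 X G) (K2 : ℝ) (hK2 : 0 < K2) (hc1' : CondC1' p K2 X G) (K3 : ℝ) (hK3 : 0 < K3) (hc2' : CondC2' p K3 s G) :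
    ∃ C2 : ℝ, 0 < C2 ∧ ∀ f : ℝ → ℝ, MemLpT p f → ∀ n : ℕ, 1 ≤ n →
      K2 * ellp p n (X n) (fun x => steklov r (γ / (n : ℝ)) f x - f x) - C2 * omegaMod s p f (1 / (n : ℝ)) ≤
        LpNorm p (fun x => f x - G n f x) := by
  set c0 : ℝ := γ / (2 * (s + 1) ^ 2) with hc0d
  have hc0 : 0 < c0 := by positivity
  have hs0 : (1:ℝ) ≤ s := by exact_mod_cast hs
  have hcc : c0 * (2 * ((s:ℝ) + 1) ^ 2) = γ := by rw [hc0d]; field_simp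
  have hc : s * c0 * ((s:ℝ) + 1) ≤ γ := by rw [← hcc]; nlinarith
  have hc' : c0 * ((s:ℝ) + 1) < 1 := by nlinarith
  obtain ⟨C, hC, HC⟩ := est_c hp hr hs hsr hX hγ0 hγ1 hc0 hc hc'
  obtain ⟨Cb, hCb, HB⟩ := est_b (p := p) hp hs
  refine ⟨1 + K3 * (Cb * c0⁻¹ ^ s) + K1 * C, by positivity, ?_⟩
  intro f hf n hn
  have hn0 : (0:ℝ) < n := by exact_mod_cast hn
  have hδ : 0 < γ / n := by positivity
  set h := c0 / n with hh
  have hh0 : 0 < h := by positivity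
  have hhδ : h * ((s:ℝ) + 1) < 1 / n := by
    rw [hh, show c0 / n * ((s:ℝ) + 1) = c0 * (s + 1) / n by ring]
    gcongr
  have hLI := mem_LI hp hf
  have hg := gfun_cont s hh0 hLI
  have hgm : MemLpT p (gfun s h f) := cont_mem hp hg (gfun_per s h hf.1)
  have hst := steklov_mem hp hr hδ hf
  set ω := omegaMod s p f (1 / n) with hω
  have hω0 : 0 ≤ ω := omega_nonneg _ _ _ _
  have hfg := mem_sub hp hf hgm
  have ha : LpNorm p (fun x => f x - gfun s h f x) ≤ ω := by
    rw [LpNorm_eq hp hfg.2.1]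
    exact ENNReal.toReal_le_of_le_ofReal hω0 (est_a hp hs hf hh0 hhδ)
  have hsm := (gfun_smooth s hh0 hLI).1
  have hb : LpNorm p (iteratedDeriv s (gfun s h f)) ≤ Cb * h⁻¹ ^ s * ω := by
    rw [LpNorm_eq hp (hsm.continuous_iteratedDeriv s le_rfl).measurable]
    refine ENNReal.toReal_le_of_le_ofReal (by positivity) ?_
    rw [ENNReal.ofReal_mul (by positivity)]
    exact HB hf hh0 hhδ
  have hb2 : LpNorm p (fun x => gfun s h f x - G n (gfun s h f) x) ≤ K3 * (Cb * c0⁻¹ ^ s) * ω := by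
    refine (hc2' _ ⟨gfun_per s h hf.1, hsm⟩ n hn).trans ?_
    calc _ ≤ K3 / (n:ℝ) ^ s * (Cb * h⁻¹ ^ s * ω) := by gcongr
      _ = _ := by
        rw [hh, inv_div, div_pow, inv_pow]
        field_simp
  have hd : LpNorm p (G n (fun x => gfun s h f x - steklov r (γ / n) f x)) ≤ K1 * (C * ω) :=
    (hc1 _ (mem_sub hp hgm hst) n hn).trans (mul_le_mul_of_nonneg_left (HC hf hn) hK1.le)
  have hmain := hc1' _ (mem_sub hp hst hf) n hn
  have e : G n (fun x => steklov r (γ / n) f x - f x) = fun x => (f x - G n f x) -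
      (f x - gfun s h f x) - ((gfun s h f x - G n (gfun s h f) x) +
        G n (fun x => gfun s h f x - steklov r (γ / n) f x) x) := by
    funext x
    simp only [hGform.2, sub_mul, Finset.sum_sub_distrib]
    ring
  rw [e] at hmain
  have h4 := LpNorm_four hp (mem_sub hp hf (mem_G hp hGform n f)) hfg
    (mem_sub hp hgm (mem_G hp hGform n (gfun s h f)))
    (mem_G hp hGform n (fun x => gfun s h f x - steklov r (γ / n) f x))
  linarith
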